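/- arXiv:1712.08415 — 3 statements merged into one kernel-verified Lean document; each statement's English description precedes it below -/
import Mathlib

section
/- Let a > 1. Then the function f(x) = (φ(ax) − φ(x)) / (x·(Φ(ax) + Φ(x))) is strictly increasing on the interval (0, ∞). -/
open MeasureTheory intervalIntegral

/-- `φ(x) = exp(-x²)`. -/
noncomputable def phi (x : ℝ) : ℝ := Real.exp (-x ^ 2)

/-- `Φ(x) = ∫₀ˣ φ(u) du`. -/
noncomputable def Phi (x : ℝ) : ℝ := ∫ u in (0 : ℝ)..x, phi u

/-- `φ'(x) = -2x·exp(-x²)`, the derivative of `φ`. -/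
noncomputable def phi' (x : ℝ) : ℝ := -2 * x * Real.exp (-x ^ 2)

/-- `f(x) = (φ(ax) - φ(x)) / (x·(Φ(ax) + Φ(x)))`. -/
noncomputable def f (a x : ℝ) : ℝ :=
  (phi (a * x) - phi x) / (x * (Phi (a * x) + Phi x))

/-- The Gaussian ratio `Φ(y) / (y φ(y))`, written as an integral so that it is visibly monotone. -/
noncomputable def gaussRatio (y : ℝ) : ℝ := ∫ t in (0 : ℝ)..1, Real.exp (y ^ 2 * (1 - t ^ 2))

lemma continuous_phi : Continuous phi := by
  unfold phi
  fun_prop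

lemma phi_pos (x : ℝ) : 0 < phi x := Real.exp_pos _

lemma hasDerivAt_phi (x : ℝ) : HasDerivAt phi (-2 * x * phi x) x := by
  have h := ((hasDerivAt_pow 2 x).neg).exp
  refine HasDerivAt.congr_deriv (f := phi) h ?_
  simp only [phi, Pi.neg_apply]
  push_cast
  ring

lemma hasDerivAt_Phi (x : ℝ) : HasDerivAt Phi (phi x) x :=
  integral_hasDerivAt_right (continuous_phi.intervalIntegrable _ _)
    continuous_phi.stronglyMeasurable.stronglyMeasurableAtFilter continuous_phi.continuousAt

lemma Phi_pos {x : ℝ} (hx : 0 < x) : 0 < Phi x :=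
  intervalIntegral_pos_of_pos (continuous_phi.intervalIntegrable _ _) phi_pos hx

lemma Phi_eq_mul_gaussRatio (y : ℝ) : Phi y = y * phi y * gaussRatio y := by
  have h : y * ∫ t in (0 : ℝ)..1, phi (y * t) = Phi y := by
    rw [mul_integral_comp_mul_left, mul_zero, mul_one, Phi]
  rw [← h, gaussRatio, mul_assoc, ← intervalIntegral.integral_const_mul (phi y)]
  congr 1
  refine integral_congr fun t _ => ?_
  simp only [phi, ← Real.exp_add]
  ring_nf

lemma gaussRatio_pos (y : ℝ) : 0 < gaussRatio y :=
  intervalIntegral_pos_of_pos (Continuous.intervalIntegrable (by fun_prop) _ _)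
    (fun _ => Real.exp_pos _) one_pos

lemma gaussRatio_le_gaussRatio {x y : ℝ} (hx : 0 ≤ x) (hxy : x ≤ y) :
    gaussRatio x ≤ gaussRatio y := by
  refine integral_mono_on zero_le_one (Continuous.intervalIntegrable (by fun_prop) _ _)
    (Continuous.intervalIntegrable (by fun_prop) _ _) fun t ht => ?_
  have : 0 ≤ 1 - t ^ 2 := by nlinarith [ht.1, ht.2]
  gcongr

lemma phi_eq_phi_mul_exp (a x : ℝ) :
    phi x = phi (a * x) * Real.exp ((a ^ 2 - 1) * x ^ 2) := by
  simp only [phi, ← Real.exp_add]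
  ring_nf

lemma hasDerivAt_phi_sub (a x : ℝ) :
    HasDerivAt (fun x => phi (a * x) - phi x)
      (-(2 * x * phi (a * x) * (a ^ 2 - Real.exp ((a ^ 2 - 1) * x ^ 2)))) x := by
  have h := (hasDerivAt_phi (a * x)).comp x ((hasDerivAt_id x).const_mul a)
  refine (h.sub (hasDerivAt_phi x)).congr_deriv ?_
  rw [phi_eq_phi_mul_exp a x]
  ring

lemma hasDerivAt_mul_Phi_add (a x : ℝ) :
    HasDerivAt (fun x => x * (Phi (a * x) + Phi x))
      (x * phi (a * x) * (a * gaussRatio (a * x) + a +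
        Real.exp ((a ^ 2 - 1) * x ^ 2) * (gaussRatio x + 1))) x := by
  have h := (hasDerivAt_Phi (a * x)).comp x ((hasDerivAt_id x).const_mul a)
  refine ((hasDerivAt_id x).mul (h.add (hasDerivAt_Phi x))).congr_deriv ?_
  simp only [Pi.add_apply, Function.comp_apply, id]
  rw [Phi_eq_mul_gaussRatio x, Phi_eq_mul_gaussRatio (a * x),
    phi_eq_phi_mul_exp a x]
  ring

theorem statement_0 (a : ℝ) (ha : 1 < a) :
    StrictMonoOn (f a) (Set.Ioi (0 : ℝ)) := by
  have ha2 : 0 < a ^ 2 - 1 := by nlinarith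
  set E : ℝ → ℝ := fun x => Real.exp ((a ^ 2 - 1) * x ^ 2) with hE
  set P : ℝ → ℝ := fun x => a ^ 2 - E x
  set Q : ℝ → ℝ := fun x => a * gaussRatio (a * x) + a + E x * (gaussRatio x + 1) with hQ
  have hN (x : ℝ) : HasDerivAt (fun x => phi (a * x) - phi x) (-(2 * x * phi (a * x) * P x)) x :=
    hasDerivAt_phi_sub a x
  have hD (x : ℝ) : HasDerivAt (fun x => x * (Phi (a * x) + Phi x)) (x * phi (a * x) * Q x) x :=
    hasDerivAt_mul_Phi_add a x
  have hDpos {x : ℝ} (hx : 0 < x) : 0 < x * (Phi (a * x) + Phi x) :=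
    mul_pos hx (add_pos (Phi_pos (by positivity)) (Phi_pos hx))
  have hQpos (x : ℝ) : 0 < Q x := by
    have := gaussRatio_pos (a * x)
    have := gaussRatio_pos x
    positivity
  have hNneg {x : ℝ} (hx : 0 < x) : phi (a * x) - phi x < 0 := by
    refine sub_neg.2 (Real.exp_lt_exp.2 ?_)
    nlinarith [mul_pos ha2 (pow_pos hx 2)]
  have hf {x : ℝ} (hx : 0 < x) := (hN x).div (hD x) (hDpos hx).ne'
  refine strictMonoOn_of_deriv_pos (convex_Ioi 0)
    (fun x hx => (hf hx).continuousAt.continuousWithinAt) fun x hx => ?_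
  rw [interior_Ioi, Set.mem_Ioi] at hx
  rw [HasDerivAt.deriv (f := f a) (hf hx)]
  refine div_pos ?_ (pow_pos (hDpos hx) 2)
  have hφx := phi_pos (a * x)
  rcases le_or_gt (P x) 0 with hPx | hPx
  · have h1 : 0 ≤ -(2 * x * phi (a * x) * P x) :=
      neg_nonneg.2 (mul_nonpos_of_nonneg_of_nonpos (by positivity) hPx)
    have h2 := mul_neg_of_neg_of_pos (hNneg hx) (mul_pos (mul_pos hx hφx) (hQpos x))
    have h3 := mul_nonneg h1 (hDpos hx).le
    linarith
  -- Cauchy's mean value theorem compares the quotient with the quotient of derivatives.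
  obtain ⟨c, ⟨hc, hcx⟩, hslope⟩ := exists_ratio_hasDerivAt_eq_ratio_slope _ _ hx
    (fun y _ => (hN y).continuousAt.continuousWithinAt) (fun y _ => hN y) _ _
    (fun y _ => (hD y).continuousAt.continuousWithinAt) (fun y _ => hD y)
  simp only [mul_zero, sub_self, zero_mul, sub_zero] at hslope
  have hEcx : E c < E x := by
    simp only [hE]
    gcongr
  have hPcx : P x < P c := sub_lt_sub_left hEcx _
  have hQcx : Q c ≤ Q x := by
    have h1 := gaussRatio_le_gaussRatio hc.le hcx.le
    have h2 : gaussRatio (a * c) ≤ gaussRatio (a * x) :=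
      gaussRatio_le_gaussRatio (by positivity) (by gcongr)
    have := gaussRatio_pos c
    simp only [hQ]
    gcongr
  have hNx := hNneg hx
  have hDx := hDpos hx
  set D := x * (Phi (a * x) + Phi x)
  set N := phi (a * x) - phi x
  have hNQ : N * Q c = -(2 * D * P c) := by
    refine mul_left_cancel₀ (mul_pos hc (phi_pos (a * c))).ne' ?_
    linear_combination -hslope
  have h1 : N * Q x ≤ N * Q c := mul_le_mul_of_nonpos_left hQcx hNx.le
  have h2 : D * P x < D * P c := mul_lt_mul_of_pos_left hPcx hDx
  have h3 : 0 < x * phi (a * x) * (-(2 * D * P x) - N * Q x) :=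
    mul_pos (mul_pos hx hφx) (by linarith)
  linarith
end

section
/- Let 0 < a < 1. Then the function f(x) = (φ(ax) − φ(x)) / (x·(Φ(ax) + Φ(x))) is strictly decreasing on the interval (0, ∞). -/
open MeasureTheory intervalIntegral

theorem Phi_mul_eq (b x : ℝ) :
    Phi (b * x) = x * ∫ t in (0 : ℝ)..b, Real.exp (-(x ^ 2 * t ^ 2)) := by
  have h := intervalIntegral.smul_integral_comp_mul_left (a := 0) (b := b) phi x
  rw [mul_zero, mul_comm x b, smul_eq_mul] at h
  rw [Phi, ← h]
  simp only [phi, mul_pow]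

theorem integral_two_mul_exp_neg_sq (a : ℝ) {x : ℝ} (hx : x ≠ 0) :
    ∫ t in a..1, 2 * t * Real.exp (-(x ^ 2 * t ^ 2)) = (phi (a * x) - phi x) / x ^ 2 := by
  have hderiv (t : ℝ) : HasDerivAt (fun t => -Real.exp (-(x ^ 2 * t ^ 2)) / x ^ 2)
      (2 * t * Real.exp (-(x ^ 2 * t ^ 2))) t := by
    have h := ((((hasDerivAt_id t).pow 2).const_mul (x ^ 2)).neg.exp.neg).div_const (x ^ 2)
    refine h.congr_deriv ?_
    simp
    field_simp
  rw [intervalIntegral.integral_eq_sub_of_hasDerivAt (fun t _ => hderiv t)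
    (Continuous.intervalIntegrable (by fun_prop) _ _)]
  simp only [phi, mul_pow]
  ring_nf

theorem f_eq_integral_div (a : ℝ) {x : ℝ} (hx : x ≠ 0) :
    f a x = (∫ t in a..1, 2 * t * Real.exp (-(x ^ 2 * t ^ 2))) /
      (2 * (∫ t in (0 : ℝ)..a, Real.exp (-(x ^ 2 * t ^ 2))) +
        ∫ t in a..1, Real.exp (-(x ^ 2 * t ^ 2))) := by
  have hint (b c : ℝ) : IntervalIntegrable (fun t : ℝ => Real.exp (-(x ^ 2 * t ^ 2))) volume b c :=
    Continuous.intervalIntegrable (by fun_prop) _ _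
  have h1 := Phi_mul_eq 1 x
  rw [one_mul, ← intervalIntegral.integral_add_adjacent_intervals (hint 0 a) (hint a 1)] at h1
  rw [integral_two_mul_exp_neg_sq a hx, f, Phi_mul_eq a x, h1, div_div]
  congr 1
  ring

theorem exp_mul_integral_lt {a x y τ : ℝ} (ha : 0 < a) (haτ : a ≤ τ) (hxy : x ^ 2 < y ^ 2) :
    Real.exp (-((y ^ 2 - x ^ 2) * τ ^ 2)) * (∫ t in (0 : ℝ)..a, Real.exp (-(x ^ 2 * t ^ 2))) <
      ∫ t in (0 : ℝ)..a, Real.exp (-(y ^ 2 * t ^ 2)) := by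
  rw [← intervalIntegral.integral_const_mul, ← sub_pos, ← intervalIntegral.integral_sub
    (Continuous.intervalIntegrable (by fun_prop) _ _)
    (Continuous.intervalIntegrable (by fun_prop) _ _)]
  refine intervalIntegral.intervalIntegral_pos_of_pos_on
    (Continuous.intervalIntegrable (by fun_prop) _ _) (fun t ht => ?_) ha
  rw [sub_pos, ← Real.exp_add, Real.exp_lt_exp]
  have hsq : t ^ 2 < τ ^ 2 := pow_lt_pow_left₀ (ht.2.trans_le haτ) ht.1.le two_ne_zero
  nlinarith [mul_pos (sub_pos.2 hxy) (sub_pos.2 hsq)]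

theorem integral_sub_mul_exp_le {a x y m : ℝ} (ha0 : 0 ≤ a) (ha1 : a ≤ 1)
    (hxy : x ^ 2 ≤ y ^ 2) :
    (∫ t in a..1, (2 * t - m) * Real.exp (-(y ^ 2 * t ^ 2))) ≤
      Real.exp (-((y ^ 2 - x ^ 2) * (max a (m / 2)) ^ 2)) *
        ∫ t in a..1, (2 * t - m) * Real.exp (-(x ^ 2 * t ^ 2)) := by
  rw [← intervalIntegral.integral_const_mul]
  refine intervalIntegral.integral_mono_on ha1
    (Continuous.intervalIntegrable (by fun_prop) _ _)
    (Continuous.intervalIntegrable (by fun_prop) _ _) (fun t ht => ?_)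
  rw [mul_left_comm, ← Real.exp_add]
  have hd := sub_nonneg.2 hxy
  have ht0 : 0 ≤ t := ha0.trans ht.1
  rcases le_total (m / 2) t with h | h
  · refine mul_le_mul_of_nonneg_left (Real.exp_le_exp.2 ?_) (by linarith)
    have hsq : (max a (m / 2)) ^ 2 ≤ t ^ 2 :=
      pow_le_pow_left₀ (ha0.trans (le_max_left _ _)) (max_le ht.1 h) 2
    nlinarith [mul_nonneg hd (sub_nonneg.2 hsq)]
  · refine mul_le_mul_of_nonpos_left (Real.exp_le_exp.2 ?_) (by linarith)
    have hsq : t ^ 2 ≤ (max a (m / 2)) ^ 2 := pow_le_pow_left₀ ht0 (h.trans (le_max_right _ _)) 2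
    nlinarith [mul_nonneg hd (sub_nonneg.2 hsq)]

theorem integral_sub_mul_exp_eq (a x m : ℝ) :
    (∫ t in a..1, (2 * t - m) * Real.exp (-(x ^ 2 * t ^ 2))) =
      (∫ t in a..1, 2 * t * Real.exp (-(x ^ 2 * t ^ 2))) -
        m * ∫ t in a..1, Real.exp (-(x ^ 2 * t ^ 2)) := by
  rw [← intervalIntegral.integral_const_mul, ← intervalIntegral.integral_sub
    (Continuous.intervalIntegrable (by fun_prop) _ _)
    (Continuous.intervalIntegrable (by fun_prop) _ _)]
  simp only [sub_mul]

theorem statement_1 (a : ℝ) (ha0 : 0 < a) (ha1 : a < 1) :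
    StrictAntiOn (f a) (Set.Ioi (0 : ℝ)) := by
  intro x hx y hy hxy
  have hx0 : 0 < x := hx
  have hy0 : 0 < y := hy
  have hsq : x ^ 2 < y ^ 2 := pow_lt_pow_left₀ hxy hx0.le two_ne_zero
  have hpos (z : ℝ) {b c : ℝ} (hbc : b < c) : 0 < ∫ t in b..c, Real.exp (-(z ^ 2 * t ^ 2)) :=
    intervalIntegral.intervalIntegral_pos_of_pos
      (Continuous.intervalIntegrable (by fun_prop) _ _) (fun t => Real.exp_pos _) hbc
  have hden (z : ℝ) : 0 < 2 * (∫ t in (0 : ℝ)..a, Real.exp (-(z ^ 2 * t ^ 2))) +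
      ∫ t in a..1, Real.exp (-(z ^ 2 * t ^ 2)) := by
    linarith [hpos z ha0, hpos z ha1]
  have hnum : 0 < ∫ t in a..1, 2 * t * Real.exp (-(x ^ 2 * t ^ 2)) :=
    intervalIntegral.intervalIntegral_pos_of_pos_on
      (Continuous.intervalIntegrable (by fun_prop) _ _)
      (fun t ht => mul_pos (mul_pos two_pos (ha0.trans ht.1)) (Real.exp_pos _)) ha1
  have hfx := f_eq_integral_div a hx0.ne'
  have hm : 0 < f a x := hfx ▸ div_pos hnum (hden x)
  rw [eq_div_iff (hden x).ne'] at hfx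
  rw [f_eq_integral_div a hy0.ne', div_lt_iff₀ (hden y)]
  have hA := exp_mul_integral_lt ha0 (le_max_left a (f a x / 2)) hsq
  have hB := integral_sub_mul_exp_le (m := f a x) ha0.le ha1.le hsq.le
  rw [integral_sub_mul_exp_eq, integral_sub_mul_exp_eq, ← hfx] at hB
  linear_combination hB + 2 * f a x * hA
end

section
/- Let 0 < a < 1 and x > 0. Then ∫_{−x}^{ax} ∫_{−x}^{ax} φ(u)·φ(v)·2(u+v)(u−v)² du dv < 0. -/
open MeasureTheory intervalIntegral

/-- The double integral of an odd function over a centred square vanishes. -/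
theorem integral_integral_eq_zero_of_odd {F : ℝ → ℝ → ℝ} (hF : ∀ u v, F (-u) (-v) = -F u v)
    (b : ℝ) : (∫ v in (-b)..b, ∫ u in (-b)..b, F u v) = 0 := by
  have inner_neg (v : ℝ) : (∫ u in (-b)..b, F u (-v)) = -∫ u in (-b)..b, F u v := by
    rw [← intervalIntegral.integral_neg]
    have h := intervalIntegral.integral_comp_neg (a := -b) (b := b) (fun u => F u (-v))
    rw [neg_neg] at h
    rw [← h]
    simp only [hF]
  have h := intervalIntegral.integral_comp_neg (a := -b) (b := b)
    (fun v => ∫ u in (-b)..b, F u v)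
  rw [neg_neg] at h
  simp only [inner_neg, intervalIntegral.integral_neg] at h
  linarith

theorem statement_12 (a x : ℝ) (ha0 : 0 < a) (ha1 : a < 1) (hx : 0 < x) :
    (∫ v in (-x)..(a * x), ∫ u in (-x)..(a * x),
        phi u * phi v * (2 * (u + v) * (u - v) ^ 2)) < 0 := by
  have hb : 0 < a * x := mul_pos ha0 hx
  have hbx : a * x < x := by nlinarith
  set b := a * x
  set F : ℝ → ℝ → ℝ := fun u v => phi u * phi v * (2 * (u + v) * (u - v) ^ 2) with hF
  have phi_pos (t : ℝ) : 0 < phi t := Real.exp_pos _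
  have F_cont : Continuous fun p : ℝ × ℝ => F p.2 p.1 := by
    simp only [hF, phi]; fun_prop
  have F_cont_left (v : ℝ) : Continuous fun u => F u v := by
    simp only [hF, phi]; fun_prop
  have inner_cont (c d : ℝ) : Continuous fun v => ∫ u in c..d, F u v :=
    intervalIntegral.continuous_parametric_intervalIntegral_of_continuous'
      (f := fun v u => F u v) F_cont c d
  have F_nonpos (u v : ℝ) (h : u + v ≤ 0) : F u v ≤ 0 :=
    mul_nonpos_of_nonneg_of_nonpos (mul_pos (phi_pos u) (phi_pos v)).le
      (mul_nonpos_of_nonpos_of_nonneg (by linarith) (sq_nonneg _))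
  have F_odd (u v : ℝ) : F (-u) (-v) = -F u v := by
    simp only [hF, phi, neg_sq]; ring
  have inner_neg (v : ℝ) (hv : v < -b) : (∫ u in (-x)..b, F u v) < 0 := by
    have h := intervalIntegral.integral_lt_integral_of_continuousOn_of_le_of_exists_lt
      (a := -x) (b := b) (f := fun u => F u v) (g := fun _ => 0) (by linarith)
      (F_cont_left v).continuousOn continuousOn_const
      (fun u hu => F_nonpos u v (by linarith [hu.2]))
      ⟨0, ⟨by linarith, hb.le⟩, mul_neg_of_pos_of_neg (mul_pos (phi_pos 0) (phi_pos v))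
        (mul_neg_of_neg_of_pos (by linarith) (pow_pos (by linarith) 2))⟩
    simpa using h
  have strip_neg : (∫ v in (-x)..(-b), ∫ u in (-x)..b, F u v) < 0 := by
    have h := intervalIntegral.intervalIntegral_pos_of_pos_on
      (f := fun v => -∫ u in (-x)..b, F u v) (a := -x) (b := -b)
      ((inner_cont _ _).neg.intervalIntegrable _ _)
      (fun v hv => neg_pos.2 (inner_neg v hv.2)) (by linarith)
    rw [intervalIntegral.integral_neg] at h
    linarith
  have rect_nonpos : (∫ v in (-b)..b, ∫ u in (-x)..(-b), F u v) ≤ 0 := by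
    have h := intervalIntegral.integral_nonneg (μ := volume) (a := -b) (b := b)
      (f := fun v => -∫ u in (-x)..(-b), F u v) (by linarith) (fun v hv => by
        rw [← intervalIntegral.integral_neg]
        exact intervalIntegral.integral_nonneg (by linarith)
          (fun u hu => neg_nonneg.2 (F_nonpos u v (by linarith [hu.2, hv.2]))))
    rw [intervalIntegral.integral_neg] at h
    linarith
  have split_inner (v : ℝ) : (∫ u in (-x)..b, F u v) =
      (∫ u in (-x)..(-b), F u v) + ∫ u in (-b)..b, F u v :=
    (intervalIntegral.integral_add_adjacent_intervals
      ((F_cont_left v).intervalIntegrable _ _) ((F_cont_left v).intervalIntegrable _ _)).symm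
  have split_centre : (∫ v in (-b)..b, ∫ u in (-x)..b, F u v) =
      (∫ v in (-b)..b, ∫ u in (-x)..(-b), F u v) + ∫ v in (-b)..b, ∫ u in (-b)..b, F u v := by
    simp only [split_inner]
    exact intervalIntegral.integral_add ((inner_cont _ _).intervalIntegrable _ _)
      ((inner_cont _ _).intervalIntegrable _ _)
  have split_outer := intervalIntegral.integral_add_adjacent_intervals (μ := volume)
    ((inner_cont (-x) b).intervalIntegrable (-x) (-b))
    ((inner_cont (-x) b).intervalIntegrable (-b) b)
  have centre_zero := integral_integral_eq_zero_of_odd F_odd b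
  change (∫ v in (-x)..b, ∫ u in (-x)..b, F u v) < 0
  linarith
end
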